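/- Let f, g be linearly independent homogeneous polynomials of degree d in ℂ[x,y,z], spanning a pencil P. Suppose f and g are semistable and every nonzero member of P not proportional to f and not proportional to g is stable. Then P is semistable, and P fails to be stable if and only if there exist A ∈ SL(3,ℂ) and a normalized weight triple (a_x, a_y, a_z) such that ω(f∘A) = (d/3)·s and ω(g∘A) = (d/3)·s, i.e., f and g are simultaneously non-stable with respect to the same one-parameter subgroup and choice of coordinates. -/

import Mathlib

/-- The coefficient `f_{ij}` of the monomial `x^i y^j z^(d-i-j)` in a polynomial
`f ∈ ℂ[x,y,z]`, regarded as a plane curve of degree `d`. -/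
noncomputable def coeffIJ (d : ℕ) (f : MvPolynomial (Fin 3) ℂ) (i j : ℕ) : ℂ :=
  MvPolynomial.coeff
    (Finsupp.single (0 : Fin 3) i + Finsupp.single (1 : Fin 3) j +
      Finsupp.single (2 : Fin 3) (d - i - j)) f

/-- A normalized weight triple `(ax, ay, az)`:
`ax ≥ ay ≥ az`, `ax > 0` and `ax + ay + az = 0`. -/
def NormTriple (ax ay az : ℤ) : Prop :=
  ay ≤ ax ∧ az ≤ ay ∧ 0 < ax ∧ ax + ay + az = 0

/-- The affine weight `ω(f) = min {(ax-az)·i + (ay-az)·j : f_{ij} ≠ 0}` of a plane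
curve of degree `d` at a normalized weight triple. -/
noncomputable def curveWeight (ax ay az : ℤ) (d : ℕ) (f : MvPolynomial (Fin 3) ℂ) : ℤ :=
  sInf {w : ℤ | ∃ i j : ℕ, coeffIJ d f i j ≠ 0 ∧
    w = (ax - az) * (i : ℤ) + (ay - az) * (j : ℤ)}

/-- The Plücker coordinate (2×2 minor) `m_{ijkl} = f_{ij} g_{kl} - g_{ij} f_{kl}`
of the pencil spanned by `f` and `g`. -/
noncomputable def minor (d : ℕ) (f g : MvPolynomial (Fin 3) ℂ) (i j k l : ℕ) : ℂ :=
  coeffIJ d f i j * coeffIJ d g k l - coeffIJ d g i j * coeffIJ d f k l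

/-- The affine weight `ω(P) = min {(ax-az)(i+k) + (ay-az)(j+l) : m_{ijkl} ≠ 0}` of the
pencil spanned by `f` and `g` at a normalized weight triple. -/
noncomputable def pencilWeight (ax ay az : ℤ) (d : ℕ) (f g : MvPolynomial (Fin 3) ℂ) : ℤ :=
  sInf {w : ℤ | ∃ i j k l : ℕ, minor d f g i j k l ≠ 0 ∧
    w = (ax - az) * ((i : ℤ) + (k : ℤ)) + (ay - az) * ((j : ℤ) + (l : ℤ))}

/-- The action of `A ∈ SL(3,ℂ)` on polynomials by the linear substitution
`(x,y,z) ↦ A·(x,y,z)`. -/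
noncomputable def actSL (A : Matrix.SpecialLinearGroup (Fin 3) ℂ)
    (f : MvPolynomial (Fin 3) ℂ) : MvPolynomial (Fin 3) ℂ :=
  MvPolynomial.aeval
    (fun i => ∑ j : Fin 3,
      MvPolynomial.C ((A : Matrix (Fin 3) (Fin 3) ℂ) i j) * MvPolynomial.X j) f

/-- A degree-`d` plane curve `f` is semistable if `ω(f∘A) ≤ (d/3)·s` for every
`A ∈ SL(3,ℂ)` and every normalized weight triple, where `s = (ax-az)+(ay-az)`. -/
def CurveSemistable (d : ℕ) (f : MvPolynomial (Fin 3) ℂ) : Prop :=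
  ∀ A : Matrix.SpecialLinearGroup (Fin 3) ℂ, ∀ ax ay az : ℤ, NormTriple ax ay az →
    (curveWeight ax ay az d (actSL A f) : ℚ) ≤
      (d : ℚ) / 3 * (((ax - az) + (ay - az) : ℤ) : ℚ)

/-- A degree-`d` plane curve `f` is stable if `ω(f∘A) < (d/3)·s` for every
`A ∈ SL(3,ℂ)` and every normalized weight triple. -/
def CurveStable (d : ℕ) (f : MvPolynomial (Fin 3) ℂ) : Prop :=
  ∀ A : Matrix.SpecialLinearGroup (Fin 3) ℂ, ∀ ax ay az : ℤ, NormTriple ax ay az →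
    (curveWeight ax ay az d (actSL A f) : ℚ) <
      (d : ℚ) / 3 * (((ax - az) + (ay - az) : ℤ) : ℚ)

/-- The pencil spanned by `f` and `g` is semistable if `ω(P∘A) ≤ (2d/3)·s` for every
`A ∈ SL(3,ℂ)` and every normalized weight triple. -/
def PencilSemistable (d : ℕ) (f g : MvPolynomial (Fin 3) ℂ) : Prop :=
  ∀ A : Matrix.SpecialLinearGroup (Fin 3) ℂ, ∀ ax ay az : ℤ, NormTriple ax ay az →
    (pencilWeight ax ay az d (actSL A f) (actSL A g) : ℚ) ≤
      (2 * d : ℚ) / 3 * (((ax - az) + (ay - az) : ℤ) : ℚ)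

/-- The pencil spanned by `f` and `g` is stable if `ω(P∘A) < (2d/3)·s` for every
`A ∈ SL(3,ℂ)` and every normalized weight triple. -/
def PencilStable (d : ℕ) (f g : MvPolynomial (Fin 3) ℂ) : Prop :=
  ∀ A : Matrix.SpecialLinearGroup (Fin 3) ℂ, ∀ ax ay az : ℤ, NormTriple ax ay az →
    (pencilWeight ax ay az d (actSL A f) (actSL A g) : ℚ) <
      (2 * d : ℚ) / 3 * (((ax - az) + (ay - az) : ℤ) : ℚ)

open MvPolynomial in
/-- The substitution by `A⁻¹` undoes the substitution by `A`. -/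
theorem actSL_inv_actSL (A : Matrix.SpecialLinearGroup (Fin 3) ℂ)
    (f : MvPolynomial (Fin 3) ℂ) : actSL A⁻¹ (actSL A f) = f := by
  have hA : (A : Matrix (Fin 3) (Fin 3) ℂ) * ((A⁻¹ : Matrix.SpecialLinearGroup (Fin 3) ℂ) :
      Matrix (Fin 3) (Fin 3) ℂ) = 1 := by
    rw [← Matrix.SpecialLinearGroup.coe_mul, mul_inv_cancel, Matrix.SpecialLinearGroup.coe_one]
  unfold actSL
  rw [← AlgHom.comp_apply]
  conv_rhs => rw [← AlgHom.id_apply (R := ℂ) f]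
  congr 1
  ext1 i
  have hrow : ∀ k, ∑ j, (A : Matrix (Fin 3) (Fin 3) ℂ) i j *
      ((A⁻¹ : Matrix.SpecialLinearGroup (Fin 3) ℂ) : Matrix (Fin 3) (Fin 3) ℂ) j k =
        (1 : Matrix (Fin 3) (Fin 3) ℂ) i k := fun k => by
    rw [← hA, Matrix.mul_apply]
  simp only [AlgHom.comp_apply, aeval_X, map_sum, map_mul, algHom_C, algebraMap_eq,
    AlgHom.id_apply, Finset.mul_sum]
  rw [Finset.sum_comm]
  simp only [← mul_assoc, ← Finset.sum_mul, ← map_mul, ← map_sum, hrow]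
  simp [Matrix.one_apply]

theorem actSL_ne_zero (A : Matrix.SpecialLinearGroup (Fin 3) ℂ)
    {f : MvPolynomial (Fin 3) ℂ} (hf : f ≠ 0) : actSL A f ≠ 0 := by
  intro h
  apply hf
  rw [← actSL_inv_actSL A f, h]
  simp [actSL]

theorem actSL_isHomogeneous (A : Matrix.SpecialLinearGroup (Fin 3) ℂ) {d : ℕ}
    {f : MvPolynomial (Fin 3) ℂ} (hf : f.IsHomogeneous d) : (actSL A f).IsHomogeneous d := by
  have h := hf.aeval (n := 1) (fun i => ∑ j : Fin 3,
      MvPolynomial.C ((A : Matrix (Fin 3) (Fin 3) ℂ) i j) * MvPolynomial.X j) fun i =>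
    MvPolynomial.IsHomogeneous.sum _ _ _ fun j _ => (MvPolynomial.isHomogeneous_X ℂ j).C_mul _
  rwa [one_mul] at h

theorem actSL_smul_sub_smul (A : Matrix.SpecialLinearGroup (Fin 3) ℂ) (a b : ℂ)
    (f g : MvPolynomial (Fin 3) ℂ) :
    actSL A (a • f - b • g) = a • actSL A f - b • actSL A g := by
  simp [actSL]

theorem exists_coeffIJ_ne_zero {d : ℕ} {f : MvPolynomial (Fin 3) ℂ}
    (hf : f.IsHomogeneous d) (h0 : f ≠ 0) : ∃ i j : ℕ, coeffIJ d f i j ≠ 0 := by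
  obtain ⟨m, hm⟩ := MvPolynomial.ne_zero_iff.mp h0
  have hdeg : m 0 + m 1 + m 2 = d := by
    have := hf hm
    rwa [Finsupp.weight_apply, Finsupp.sum_fintype _ _ (by simp), Fin.sum_univ_three,
      Pi.one_apply, Pi.one_apply, Pi.one_apply, smul_eq_mul, smul_eq_mul, smul_eq_mul, mul_one,
      mul_one, mul_one] at this
  refine ⟨m 0, m 1, ?_⟩
  have hm' : Finsupp.single (0 : Fin 3) (m 0) + Finsupp.single (1 : Fin 3) (m 1) +
      Finsupp.single (2 : Fin 3) (d - m 0 - m 1) = m := by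
    ext k
    fin_cases k <;> simp
    omega
  rwa [coeffIJ, hm']

section Weights

variable {ax ay az : ℤ}

theorem curveWeight_le (hn : NormTriple ax ay az) {d : ℕ} {f : MvPolynomial (Fin 3) ℂ} {i j : ℕ}
    (h : coeffIJ d f i j ≠ 0) :
    curveWeight ax ay az d f ≤ (ax - az) * (i : ℤ) + (ay - az) * (j : ℤ) := by
  obtain ⟨h1, h2, -, -⟩ := hn
  refine csInf_le ⟨0, ?_⟩ ⟨i, j, h, rfl⟩
  rintro w ⟨k, l, -, rfl⟩
  have : 0 ≤ ax - az := by linarith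
  have : 0 ≤ ay - az := by linarith
  positivity

theorem pencilWeight_le (hn : NormTriple ax ay az) {d : ℕ} {f g : MvPolynomial (Fin 3) ℂ}
    {i j k l : ℕ} (h : minor d f g i j k l ≠ 0) :
    pencilWeight ax ay az d f g ≤
      (ax - az) * ((i : ℤ) + (k : ℤ)) + (ay - az) * ((j : ℤ) + (l : ℤ)) := by
  obtain ⟨h1, h2, -, -⟩ := hn
  refine csInf_le ⟨0, ?_⟩ ⟨i, j, k, l, h, rfl⟩
  rintro w ⟨i, j, k, l, -, rfl⟩
  have : 0 ≤ ax - az := by linarith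
  have : 0 ≤ ay - az := by linarith
  positivity

theorem exists_curveWeight_eq (hn : NormTriple ax ay az) {d : ℕ} {f : MvPolynomial (Fin 3) ℂ}
    (hf : f.IsHomogeneous d) (h0 : f ≠ 0) :
    ∃ i j : ℕ, coeffIJ d f i j ≠ 0 ∧
      curveWeight ax ay az d f = (ax - az) * (i : ℤ) + (ay - az) * (j : ℤ) := by
  obtain ⟨i, j, hij⟩ := exists_coeffIJ_ne_zero hf h0
  obtain ⟨h1, h2, -, -⟩ := hn
  refine Int.csInf_mem (s := {w : ℤ | ∃ i j : ℕ, coeffIJ d f i j ≠ 0 ∧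
    w = (ax - az) * (i : ℤ) + (ay - az) * (j : ℤ)}) ⟨_, i, j, hij, rfl⟩ ⟨0, ?_⟩
  rintro w ⟨k, l, -, rfl⟩
  have : 0 ≤ ax - az := by linarith
  have : 0 ≤ ay - az := by linarith
  positivity

theorem curveWeight_smul {c : ℂ} (hc : c ≠ 0) (d : ℕ) (f : MvPolynomial (Fin 3) ℂ) :
    curveWeight ax ay az d (c • f) = curveWeight ax ay az d f := by
  simp [curveWeight, coeffIJ, hc]

/-- The weight of a pencil is at least the sum of the weights of any two generators. -/
theorem curveWeight_add_curveWeight_le (hn : NormTriple ax ay az) {d : ℕ}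
    {f g : MvPolynomial (Fin 3) ℂ} (hex : ∃ i j k l : ℕ, minor d f g i j k l ≠ 0) :
    curveWeight ax ay az d f + curveWeight ax ay az d g ≤ pencilWeight ax ay az d f g := by
  obtain ⟨i, j, k, l, h⟩ := hex
  refine le_csInf ⟨_, i, j, k, l, h, rfl⟩ ?_
  rintro w ⟨i, j, k, l, hm, rfl⟩
  have hcases : (coeffIJ d f i j ≠ 0 ∧ coeffIJ d g k l ≠ 0) ∨
      (coeffIJ d g i j ≠ 0 ∧ coeffIJ d f k l ≠ 0) := by
    by_contra hcon
    simp only [not_or, ← mul_ne_zero_iff, ne_eq, not_not] at hcon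
    exact hm (by rw [minor, hcon.1, hcon.2, sub_zero])
  rcases hcases with ⟨h1, h2⟩ | ⟨h1, h2⟩
  · linarith [curveWeight_le hn h1, curveWeight_le hn h2]
  · linarith [curveWeight_le hn h1, curveWeight_le hn h2]

end Weights

theorem CurveStable.semistable {d : ℕ} {f : MvPolynomial (Fin 3) ℂ} (h : CurveStable d f) :
    CurveSemistable d f :=
  fun A ax ay az hn => (h A ax ay az hn).le

theorem CurveSemistable.smul {d : ℕ} {f : MvPolynomial (Fin 3) ℂ} (h : CurveSemistable d f)
    {c : ℂ} (hc : c ≠ 0) : CurveSemistable d (c • f) := by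
  intro A ax ay az hn
  have : actSL A (c • f) = c • actSL A f := by simp [actSL]
  rw [this, curveWeight_smul hc]
  exact h A ax ay az hn

/-- If every nonzero member of a pencil is semistable, then each monomial occurring in one of the
generators occurs in a nonvanishing Plücker coordinate together with a monomial of weight at
most `(d/3)·s`. -/
theorem exists_minor_ne_zero {d : ℕ} {f g : MvPolynomial (Fin 3) ℂ}
    (hf : f.IsHomogeneous d) (hg : g.IsHomogeneous d)
    (hne : ∀ a b : ℂ, a ≠ 0 ∨ b ≠ 0 → a • f - b • g ≠ 0)
    (hss : ∀ a b : ℂ, a ≠ 0 ∨ b ≠ 0 → CurveSemistable d (a • f - b • g))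
    (A : Matrix.SpecialLinearGroup (Fin 3) ℂ) {ax ay az : ℤ} (hn : NormTriple ax ay az) {i j : ℕ}
    (hij : coeffIJ d (actSL A g) i j ≠ 0 ∨ coeffIJ d (actSL A f) i j ≠ 0) :
    ∃ k l : ℕ, minor d (actSL A f) (actSL A g) i j k l ≠ 0 ∧
      (((ax - az) * (k : ℤ) + (ay - az) * (l : ℤ) : ℤ) : ℚ) ≤
        (d : ℚ) / 3 * (((ax - az) + (ay - az) : ℤ) : ℚ) := by
  set a := coeffIJ d (actSL A g) i j with ha
  set b := coeffIJ d (actSL A f) i j with hb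
  have hhom : (a • f - b • g).IsHomogeneous d := by
    rw [MvPolynomial.smul_eq_C_mul, MvPolynomial.smul_eq_C_mul]
    exact (hf.C_mul a).sub (hg.C_mul b)
  obtain ⟨k, l, hkl, hw⟩ := exists_curveWeight_eq hn (actSL_isHomogeneous A hhom)
    (actSL_ne_zero A (hne a b hij))
  refine ⟨k, l, fun hm => hkl ?_, hw ▸ hss a b hij A ax ay az hn⟩
  have : coeffIJ d (actSL A (a • f - b • g)) k l =
      -minor d (actSL A f) (actSL A g) i j k l := by
    rw [actSL_smul_sub_smul, minor, ← ha, ← hb]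
    simp [coeffIJ]
  rw [this, hm, neg_zero]

/-- If `f` and `g` are semistable and every nonzero member of the
pencil not proportional to `f` nor to `g` is stable, then the pencil is semistable,
and it fails to be stable exactly when `f` and `g` are simultaneously non-stable
with respect to the same one-parameter subgroup and choice of coordinates. -/
theorem pencil_strictly_semistable_iff_two_generators
    (d : ℕ) (hd : 1 ≤ d) (f g : MvPolynomial (Fin 3) ℂ)
    (hf : f.IsHomogeneous d) (hg : g.IsHomogeneous d)
    (hind : LinearIndependent ℂ ![f, g])
    (hfss : CurveSemistable d f) (hgss : CurveSemistable d g)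
    (hrest : ∀ h ∈ Submodule.span ℂ ({f, g} : Set (MvPolynomial (Fin 3) ℂ)), h ≠ 0 →
      (¬ ∃ c : ℂ, h = c • f) → (¬ ∃ c : ℂ, h = c • g) → CurveStable d h) :
    PencilSemistable d f g ∧
    (¬ PencilStable d f g ↔
      ∃ A : Matrix.SpecialLinearGroup (Fin 3) ℂ, ∃ ax ay az : ℤ, NormTriple ax ay az ∧
        (curveWeight ax ay az d (actSL A f) : ℚ) =
          (d : ℚ) / 3 * (((ax - az) + (ay - az) : ℤ) : ℚ) ∧
        (curveWeight ax ay az d (actSL A g) : ℚ) =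
          (d : ℚ) / 3 * (((ax - az) + (ay - az) : ℤ) : ℚ)) := by
  have hne : ∀ a b : ℂ, a ≠ 0 ∨ b ≠ 0 → a • f - b • g ≠ 0 := by
    intro a b hab h0
    have := LinearIndependent.pair_iff.mp hind a (-b) (by rw [neg_smul, ← sub_eq_add_neg, h0])
    simp_all
  have hss : ∀ a b : ℂ, a ≠ 0 ∨ b ≠ 0 → CurveSemistable d (a • f - b • g) := by
    intro a b hab
    have h0 := hne a b hab
    by_cases h1 : ∃ c : ℂ, a • f - b • g = c • f
    · obtain ⟨c, hc⟩ := h1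
      rw [hc] at h0 ⊢
      exact hfss.smul (left_ne_zero_of_smul h0)
    by_cases h2 : ∃ c : ℂ, a • f - b • g = c • g
    · obtain ⟨c, hc⟩ := h2
      rw [hc] at h0 ⊢
      exact hgss.smul (left_ne_zero_of_smul h0)
    refine (hrest _ (Submodule.sub_mem _ ?_ ?_) h0 h1 h2).semistable
    · exact Submodule.smul_mem _ _ (Submodule.subset_span (by simp))
    · exact Submodule.smul_mem _ _ (Submodule.subset_span (by simp))
  have hf0 : f ≠ 0 := by simpa using hne 1 0 (by simp)
  have hg0 : g ≠ 0 := by simpa using hne 0 1 (by simp)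
  have hbound : ∀ A : Matrix.SpecialLinearGroup (Fin 3) ℂ, ∀ ax ay az : ℤ,
      NormTriple ax ay az → ∀ i j : ℕ,
      coeffIJ d (actSL A g) i j ≠ 0 ∨ coeffIJ d (actSL A f) i j ≠ 0 →
      (pencilWeight ax ay az d (actSL A f) (actSL A g) : ℚ) ≤
        (((ax - az) * (i : ℤ) + (ay - az) * (j : ℤ) : ℤ) : ℚ) +
          (d : ℚ) / 3 * (((ax - az) + (ay - az) : ℤ) : ℚ) := by
    intro A ax ay az hn i j hij
    obtain ⟨k, l, hm, hle⟩ := exists_minor_ne_zero hf hg hne hss A hn hij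
    have hp : (pencilWeight ax ay az d (actSL A f) (actSL A g) : ℚ) ≤
        (((ax - az) * ((i : ℤ) + (k : ℤ)) + (ay - az) * ((j : ℤ) + (l : ℤ)) : ℤ) : ℚ) :=
      Int.cast_le.mpr (pencilWeight_le hn hm)
    push_cast at hp hle ⊢
    linarith
  have hlef : ∀ A : Matrix.SpecialLinearGroup (Fin 3) ℂ, ∀ ax ay az : ℤ,
      NormTriple ax ay az → (pencilWeight ax ay az d (actSL A f) (actSL A g) : ℚ) ≤
        (curveWeight ax ay az d (actSL A f) : ℚ) +
          (d : ℚ) / 3 * (((ax - az) + (ay - az) : ℤ) : ℚ) := by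
    intro A ax ay az hn
    obtain ⟨i, j, hij, hw⟩ :=
      exists_curveWeight_eq hn (actSL_isHomogeneous A hf) (actSL_ne_zero A hf0)
    rw [hw]
    exact hbound A ax ay az hn i j (Or.inr hij)
  have hleg : ∀ A : Matrix.SpecialLinearGroup (Fin 3) ℂ, ∀ ax ay az : ℤ,
      NormTriple ax ay az → (pencilWeight ax ay az d (actSL A f) (actSL A g) : ℚ) ≤
        (curveWeight ax ay az d (actSL A g) : ℚ) +
          (d : ℚ) / 3 * (((ax - az) + (ay - az) : ℤ) : ℚ) := by
    intro A ax ay az hn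
    obtain ⟨i, j, hij, hw⟩ :=
      exists_curveWeight_eq hn (actSL_isHomogeneous A hg) (actSL_ne_zero A hg0)
    rw [hw]
    exact hbound A ax ay az hn i j (Or.inl hij)
  refine ⟨fun A ax ay az hn => ?_, fun hns => ?_, ?_⟩
  · linarith [hlef A ax ay az hn, hfss A ax ay az hn]
  · unfold PencilStable at hns
    push Not at hns
    obtain ⟨A, ax, ay, az, hn, hle⟩ := hns
    refine ⟨A, ax, ay, az, hn, le_antisymm (hfss A ax ay az hn) ?_,
      le_antisymm (hgss A ax ay az hn) ?_⟩
    · linarith [hlef A ax ay az hn]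
    · linarith [hleg A ax ay az hn]
  · rintro ⟨A, ax, ay, az, hn, hfw, hgw⟩ hst
    obtain ⟨i, j, hij⟩ := exists_coeffIJ_ne_zero (actSL_isHomogeneous A hf) (actSL_ne_zero A hf0)
    obtain ⟨k, l, hm, -⟩ := exists_minor_ne_zero hf hg hne hss A hn (Or.inr hij)
    have hsum : (curveWeight ax ay az d (actSL A f) : ℚ) + curveWeight ax ay az d (actSL A g) ≤
        pencilWeight ax ay az d (actSL A f) (actSL A g) := by
      exact_mod_cast curveWeight_add_curveWeight_le hn ⟨i, j, k, l, hm⟩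
    linarith [hst A ax ay az hn]
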